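/- arXiv:math/0703548 — 2 statements merged into one kernel-verified Lean document; each statement's English description precedes it below -/
import Mathlib

section
/- Let F be a field of characteristic zero and let G be any group. Then the group ring F[G] is stably finite; that is, for every n ≥ 1 and all matrices A, B ∈ M_n(F[G]), AB = 1 implies BA = 1. -/
/-- A positive faithful trace on a star ring for which every left multiplication is bounded in the
seminorm `x ↦ τ (star x * x)`. -/
structure IsBoundedFaithfulTrace {R : Type*} [Ring R] [StarRing R] [Algebra ℝ R]
    (τ : R →ₗ[ℝ] ℝ) : Prop where
  map_mul_comm (x y : R) : τ (x * y) = τ (y * x)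
  nonneg (x : R) : 0 ≤ τ (star x * x)
  eq_zero_of_map_star_mul_self (x : R) : τ (star x * x) = 0 → x = 0
  exists_bound (a : R) : ∃ C, ∀ x, τ (star (a * x) * (a * x)) ≤ C * τ (star x * x)

namespace IsBoundedFaithfulTrace

section

variable {R : Type*} [Ring R] [StarRing R] [Algebra ℝ R] {τ : R →ₗ[ℝ] ℝ}

theorem exists_one_le_bound (hτ : IsBoundedFaithfulTrace τ) (a : R) :
    ∃ C, 1 ≤ C ∧ ∀ x, τ (star (a * x) * (a * x)) ≤ C * τ (star x * x) := by
  obtain ⟨C, hC⟩ := hτ.exists_bound a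
  exact ⟨max C 1, le_max_right _ _, fun x ↦
    (hC x).trans (mul_le_mul_of_nonneg_right (le_max_left _ _) (hτ.nonneg x))⟩

/-- The traces of the powers of `1 - c • (star a * a)` and `1 - c • (a * star a)` agree. -/
theorem map_one_sub_smul_pow (hτ : IsBoundedFaithfulTrace τ) (a : R) (c : ℝ) (m : ℕ) :
    τ ((1 - c • (star a * a)) ^ m) = τ ((1 - c • (a * star a)) ^ m) := by
  induction m with
  | zero => simp
  | succ m ih =>
    have hsemi : SemiconjBy a (1 - c • (star a * a)) (1 - c • (a * star a)) := by
      simp [SemiconjBy, mul_sub, sub_mul, mul_assoc]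
    have hpow := (hsemi.pow_right m).eq
    have htrace : τ ((1 - c • (star a * a)) ^ m * (star a * a)) =
        τ ((1 - c • (a * star a)) ^ m * (a * star a)) := by
      rw [← mul_assoc, hτ.map_mul_comm, ← mul_assoc, hpow, mul_assoc]
    rw [pow_succ, pow_succ, mul_sub, mul_sub, mul_one, mul_one, mul_smul_comm, mul_smul_comm,
      map_sub, map_sub, map_smul, map_smul, ih, htrace]

/-- If `a` has a right inverse, then `1 - c • (a * star a)` is a strict contraction for a suitable
`c`. -/
theorem exists_contraction (hτ : IsBoundedFaithfulTrace τ) [StarModule ℝ R] {a b : R}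
    (hab : a * b = 1) : ∃ c q : ℝ, 0 ≤ q ∧ q < 1 ∧ ∀ x,
      τ (star ((1 - c • (a * star a)) * x) * ((1 - c • (a * star a)) * x)) ≤
        q * τ (star x * x) := by
  obtain ⟨M, hM, hMa⟩ := hτ.exists_one_le_bound a
  obtain ⟨K, hK, hKb⟩ := hτ.exists_one_le_bound (star b)
  have hba : star b * star a = 1 := by rw [← star_mul, hab, star_one]
  have hM0 : 0 < M := by linarith
  have hK0 : 0 < K := by linarith
  refine ⟨M⁻¹, 1 - M⁻¹ * K⁻¹, ?_, ?_, fun x ↦ ?_⟩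
  · have := mul_le_one₀ (inv_le_one_of_one_le₀ hM) (by positivity) (inv_le_one_of_one_le₀ hK)
    linarith
  · have : 0 < M⁻¹ * K⁻¹ := by positivity
    linarith
  · have hupper := hMa (star a * x)
    have hlower := hKb (star a * x)
    rw [← mul_assoc (star b), hba, one_mul] at hlower
    have hexpand : star ((1 - M⁻¹ • (a * star a)) * x) * ((1 - M⁻¹ • (a * star a)) * x) =
        star x * x - (2 * M⁻¹) • (star (star a * x) * (star a * x)) +
          (M⁻¹ * M⁻¹) • (star (a * (star a * x)) * (a * (star a * x))) := by
      simp only [star_mul, star_sub, star_smul, star_star, star_trivial, sub_mul,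
        mul_sub, one_mul, smul_mul_assoc, mul_smul_comm, mul_assoc, smul_sub]
      module
    rw [hexpand, map_add, map_sub, map_smul, map_smul, smul_eq_mul, smul_eq_mul]
    have h₁ : M⁻¹ * M⁻¹ * τ (star (a * (star a * x)) * (a * (star a * x))) ≤
        M⁻¹ * τ (star (star a * x) * (star a * x)) := by
      rw [mul_assoc]
      refine mul_le_mul_of_nonneg_left ?_ (by positivity)
      rwa [inv_mul_le_iff₀ hM0]
    have h₂ : M⁻¹ * K⁻¹ * τ (star x * x) ≤ M⁻¹ * τ (star (star a * x) * (star a * x)) := by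
      rw [mul_assoc]
      refine mul_le_mul_of_nonneg_left ?_ (by positivity)
      rwa [inv_mul_le_iff₀ hK0]
    linarith

theorem isDedekindFiniteMonoid (hτ : IsBoundedFaithfulTrace τ) [StarModule ℝ R] :
    IsDedekindFiniteMonoid R where
  mul_eq_one_symm {a b} hab := by
    obtain ⟨c, q, hq0, hq1, hq⟩ := hτ.exists_contraction hab
    set s := 1 - c • (a * star a) with hs
    set t := 1 - c • (star a * a) with ht
    set z := 1 - b * a with hz
    have hsstar : star s = s := by simp [hs]
    have htstar : star t = t := by simp [ht]
    have haz : a * z = 0 := by rw [hz, mul_sub, ← mul_assoc, hab]; simp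
    have htz (k : ℕ) : t ^ k * z = z := by
      induction k with
      | zero => simp
      | succ k ih => rw [pow_succ, mul_assoc, ht, sub_mul, smul_mul_assoc, mul_assoc, haz]; simpa
    have hspow (k : ℕ) : τ (star (s ^ k) * s ^ k) ≤ q ^ k * τ 1 := by
      induction k with
      | zero => simp
      | succ k ih =>
        rw [pow_succ' s, pow_succ' q, mul_assoc]
        exact (hq _).trans (mul_le_mul_of_nonneg_left ih hq0)
    obtain ⟨C, hC1, hC⟩ := hτ.exists_one_le_bound (star z)
    have hle (k : ℕ) : τ (star z * z) ≤ C * (q ^ k * τ 1) := calc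
      τ (star z * z) = τ (star (t ^ k * z) * (t ^ k * z)) := by rw [htz]
      _ = τ (star (star z * t ^ k) * (star z * t ^ k)) := by
        rw [hτ.map_mul_comm]
        simp only [star_mul, star_star, star_pow, htstar, mul_assoc]
      _ ≤ C * τ (star (t ^ k) * t ^ k) := hC _
      _ = C * τ (star (s ^ k) * s ^ k) := by
        rw [star_pow, star_pow, hsstar, htstar, ← pow_add, ← pow_add, hτ.map_one_sub_smul_pow]
      _ ≤ C * (q ^ k * τ 1) := mul_le_mul_of_nonneg_left (hspow k) (by linarith)
    have hlim : Filter.Tendsto (fun k : ℕ ↦ C * (q ^ k * τ 1)) Filter.atTop (nhds 0) := by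
      simpa using ((tendsto_pow_atTop_nhds_zero_of_lt_one hq0 hq1).mul_const (τ 1)).const_mul C
    have hz0 := hτ.eq_zero_of_map_star_mul_self z
      (le_antisymm (ge_of_tendsto' hlim hle) (hτ.nonneg z))
    exact (sub_eq_zero.mp hz0).symm

/-- Boundedness of left multiplications passes to sums. -/
theorem exists_bound_add
    (hnonneg : ∀ x : R, 0 ≤ τ (star x * x)) {a b : R}
    (ha : ∃ C, ∀ x, τ (star (a * x) * (a * x)) ≤ C * τ (star x * x))
    (hb : ∃ C, ∀ x, τ (star (b * x) * (b * x)) ≤ C * τ (star x * x)) :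
    ∃ C, ∀ x, τ (star ((a + b) * x) * ((a + b) * x)) ≤ C * τ (star x * x) := by
  obtain ⟨C, hC⟩ := ha
  obtain ⟨D, hD⟩ := hb
  refine ⟨2 * C + 2 * D, fun x ↦ ?_⟩
  have hsub := hnonneg (a * x - b * x)
  have hsum : star ((a + b) * x) * ((a + b) * x) =
      (2 : ℝ) • (star (a * x) * (a * x)) + (2 : ℝ) • (star (b * x) * (b * x)) -
        star (a * x - b * x) * (a * x - b * x) := by
    simp only [add_mul, star_add, star_sub, mul_add, sub_mul, mul_sub]
    module
  rw [hsum, map_sub, map_add, map_smul, map_smul, smul_eq_mul, smul_eq_mul]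
  linarith [hC x, hD x]

end

section Matrix

variable {R : Type*} [Ring R] [StarRing R] [Algebra ℝ R] {τ : R →ₗ[ℝ] ℝ}
  {n : Type*} [Fintype n]

theorem map_trace_star_mul_self (x : Matrix n n R) :
    τ (star x * x).trace = ∑ l, ∑ k, τ (star (x k l) * x k l) := by
  simp [Matrix.trace, Matrix.mul_apply, Matrix.star_apply]

theorem matrix [DecidableEq n] (hτ : IsBoundedFaithfulTrace τ) :
    IsBoundedFaithfulTrace (τ ∘ₗ Matrix.traceLinearMap n ℝ R) where
  map_mul_comm x y := by
    simp only [LinearMap.comp_apply, Matrix.traceLinearMap_apply, Matrix.trace, Matrix.diag_apply,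
      Matrix.mul_apply, map_sum]
    rw [Finset.sum_comm]
    simp only [hτ.map_mul_comm]
  nonneg x := by
    simp only [LinearMap.comp_apply, Matrix.traceLinearMap_apply, map_trace_star_mul_self]
    exact Finset.sum_nonneg fun l _ ↦ Finset.sum_nonneg fun k _ ↦ hτ.nonneg _
  eq_zero_of_map_star_mul_self x hx := by
    simp only [LinearMap.comp_apply, Matrix.traceLinearMap_apply, map_trace_star_mul_self] at hx
    ext k l
    rw [Finset.sum_eq_zero_iff_of_nonneg
      fun l _ ↦ Finset.sum_nonneg fun k _ ↦ hτ.nonneg _] at hx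
    have hl := hx l (Finset.mem_univ l)
    rw [Finset.sum_eq_zero_iff_of_nonneg fun k _ ↦ hτ.nonneg _] at hl
    exact hτ.eq_zero_of_map_star_mul_self _ (hl k (Finset.mem_univ k))
  exists_bound a := by
    induction a using Matrix.induction_on' with
    | h_zero => exact ⟨0, fun x ↦ by simp⟩
    | h_add a b ha hb =>
      refine exists_bound_add (fun x ↦ ?_) ha hb
      simp only [LinearMap.comp_apply, Matrix.traceLinearMap_apply, map_trace_star_mul_self]
      exact Finset.sum_nonneg fun l _ ↦ Finset.sum_nonneg fun k _ ↦ hτ.nonneg _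
    | h_std_basis i j r =>
      obtain ⟨C, hC1, hC⟩ := hτ.exists_one_le_bound r
      refine ⟨C, fun x ↦ ?_⟩
      simp only [LinearMap.comp_apply, Matrix.traceLinearMap_apply, map_trace_star_mul_self,
        Finset.mul_sum]
      refine Finset.sum_le_sum fun l _ ↦ ?_
      rw [Finset.sum_eq_single_of_mem i (Finset.mem_univ i) fun k _ hk ↦ by
        simp [Matrix.single_mul_apply_of_ne _ _ _ _ _ hk], Matrix.single_mul_apply_same]
      refine (hC _).trans (Finset.single_le_sum
        (f := fun k ↦ C * τ (star (x k l) * x k l)) (fun k _ ↦ ?_) (Finset.mem_univ j))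
      exact mul_nonneg (by linarith) (hτ.nonneg _)

end Matrix

end IsBoundedFaithfulTrace

namespace MonoidAlgebra

variable {G : Type*} [Group G]

/-- The involution `∑ r_g g ↦ ∑ conj r_g g⁻¹` on a complex group algebra. -/
noncomputable instance complexStarRing : StarRing (MonoidAlgebra ℂ G) where
  star x := map (starAddEquiv : ℂ ≃+ ℂ).toAddMonoidHom (mapDomain (·⁻¹) x)
  star_involutive x := by
    induction x using induction_linear with
    | zero => simp
    | add x y hx hy => simp only [mapDomain_add, MonoidAlgebra.map_add, hx, hy]
    | single g r => simp
  star_add x y := by simp only [mapDomain_add, MonoidAlgebra.map_add]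
  star_mul x y := by
    induction x using induction_linear with
    | zero => simp
    | add x x' hx hx' => simp only [add_mul, mul_add, mapDomain_add, MonoidAlgebra.map_add, hx, hx']
    | single g r =>
      induction y using induction_linear with
      | zero => simp
      | add y y' hy hy' =>
        simp only [add_mul, mul_add, mapDomain_add, MonoidAlgebra.map_add, hy, hy']
      | single h s => simp [single_mul_single, mul_comm]

theorem star_single_complex (g : G) (r : ℂ) :
    star (single g r : MonoidAlgebra ℂ G) = single g⁻¹ (star r) := by
  change map _ (mapDomain _ _) = _
  simp

theorem coeff_star_complex (x : MonoidAlgebra ℂ G) (g : G) :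
    (star x).coeff g = star (x.coeff g⁻¹) := by
  classical
  induction x using induction_linear with
  | zero => simp
  | add x y hx hy => simp [hx, hy]
  | single h r =>
    rw [star_single_complex, coeff_single, coeff_single, Finsupp.single_apply,
      Finsupp.single_apply, apply_ite star, star_zero]
    simp only [inv_eq_iff_eq_inv]

instance complexStarModule : StarModule ℝ (MonoidAlgebra ℂ G) where
  star_smul c x := by
    ext g
    simp [coeff_star_complex]

/-- The real part of the coefficient of the identity. -/
noncomputable def reTrace (G : Type*) [Group G] : MonoidAlgebra ℂ G →ₗ[ℝ] ℝ where
  toFun x := (x.coeff 1).re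
  map_add' x y := by simp
  map_smul' c x := by simp

theorem reTrace_apply (x : MonoidAlgebra ℂ G) : reTrace G x = (x.coeff 1).re := rfl

theorem reTrace_star_mul_self (x : MonoidAlgebra ℂ G) :
    reTrace G (star x * x) = ∑ g ∈ x.coeff.support, Complex.normSq (x.coeff g) := by
  rw [reTrace_apply, coeff_mul_apply_right, Finsupp.sum, Complex.re_sum]
  refine Finset.sum_congr rfl fun g _ ↦ ?_
  simp [coeff_star_complex, Complex.normSq_apply]

theorem isBoundedFaithfulTrace_reTrace : IsBoundedFaithfulTrace (reTrace G) where
  map_mul_comm x y := by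
    classical
    induction x using induction_linear with
    | zero => simp
    | add x x' hx hx' => simp only [add_mul, mul_add, map_add, hx, hx']
    | single g r =>
      induction y using induction_linear with
      | zero => simp
      | add y y' hy hy' => simp only [add_mul, mul_add, map_add, hy, hy']
      | single h s =>
        simp only [reTrace_apply, single_mul_single, coeff_single, Finsupp.single_apply,
          mul_comm r s, mul_eq_one_comm (a := g)]
  nonneg x := by
    rw [reTrace_star_mul_self]
    exact Finset.sum_nonneg fun g _ ↦ Complex.normSq_nonneg _
  eq_zero_of_map_star_mul_self x hx := by
    rw [reTrace_star_mul_self,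
      Finset.sum_eq_zero_iff_of_nonneg fun g _ ↦ Complex.normSq_nonneg _] at hx
    ext g
    by_contra hg
    exact hg (Complex.normSq_eq_zero.mp (hx g (Finsupp.mem_support_iff.mpr hg)))
  exists_bound a := by
    induction a using induction_linear with
    | zero => exact ⟨0, fun x ↦ by simp⟩
    | add a b ha hb =>
      refine IsBoundedFaithfulTrace.exists_bound_add (fun x ↦ ?_) ha hb
      rw [reTrace_star_mul_self]
      exact Finset.sum_nonneg fun g _ ↦ Complex.normSq_nonneg _
    | single g r =>
      refine ⟨Complex.normSq r, fun x ↦ le_of_eq ?_⟩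
      have hsingle : star (single g r) * single g r =
          Complex.normSq r • (1 : MonoidAlgebra ℂ G) := by
        simp [star_single_complex, single_mul_single, one_def, Complex.normSq_eq_conj_mul_self]
      rw [star_mul, mul_assoc, ← mul_assoc (star (single g r)), hsingle, smul_mul_assoc, one_mul,
        mul_smul_comm, map_smul, smul_eq_mul]

instance isStablyFiniteRing_complex : IsStablyFiniteRing (MonoidAlgebra ℂ G) where
  isDedekindFiniteMonoid _ := isBoundedFaithfulTrace_reTrace.matrix.isDedekindFiniteMonoid

end MonoidAlgebra

/-- A nontrivial commutative algebra of finite type over a field has a homomorphism to any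
algebraically closed extension of that field. -/
theorem Algebra.FiniteType.nonempty_algHom_of_isAlgClosed (k S L : Type*) [Field k] [CommRing S]
    [Nontrivial S] [Algebra k S] [Algebra.FiniteType k S] [Field L] [IsAlgClosed L] [Algebra k L] :
    Nonempty (S →ₐ[k] L) := by
  obtain ⟨m, hm⟩ := Ideal.exists_maximal S
  let _ : Field (S ⧸ m) := Ideal.Quotient.field m
  have : Algebra.FiniteType k (S ⧸ m) :=
    Algebra.FiniteType.of_surjective (Ideal.Quotient.mkₐ k m) (Ideal.Quotient.mkₐ_surjective k m)
  have : Module.Finite k (S ⧸ m) := finite_of_finite_type_of_isJacobsonRing k (S ⧸ m)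
  exact ⟨(IsAlgClosed.lift : (S ⧸ m) →ₐ[k] L).comp (Ideal.Quotient.mkₐ k m)⟩

/-- Finitely many elements of a field of characteristic zero lie in a subring with a homomorphism
to `ℂ` that does not kill a prescribed nonzero element. -/
theorem exists_subring_ringHom_complex {F : Type*} [Field F] [CharZero F] {s : Set F}
    (hs : s.Finite) {c : F} (hc : c ≠ 0) :
    ∃ (S : Subring F) (f : S →+* ℂ), s ⊆ S ∧ ∀ d : S, (d : F) = c → f d ≠ 0 := by
  let S := Algebra.adjoin ℚ (insert c⁻¹ s)
  have : Algebra.FiniteType ℚ S :=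
    S.fg_iff_finiteType.mp (Subalgebra.fg_def.mpr ⟨_, hs.insert _, rfl⟩)
  obtain ⟨f'⟩ := Algebra.FiniteType.nonempty_algHom_of_isAlgClosed ℚ S ℂ
  let f : S →+* ℂ := f'
  refine ⟨S.toSubring, f, fun x hx ↦ Algebra.subset_adjoin (Set.mem_insert_of_mem _ hx),
    fun d hd hfd ↦ ?_⟩
  let e : S := ⟨c⁻¹, Algebra.subset_adjoin (Set.mem_insert _ _)⟩
  have hde : (show S from d) * e = 1 := Subtype.ext (by
    change (d : F) * c⁻¹ = 1
    rw [hd, mul_inv_cancel₀ hc])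
  have hone : f d * f e = 1 := by
    rw [← map_one f, ← hde, map_mul]
  rw [hfd, zero_mul] at hone
  exact zero_ne_one hone

/-- Let `F` be a field of characteristic zero and `G` any group.  Then the group ring `F[G]`
is stably finite: for every `n ≥ 1` and all matrices `A, B ∈ Mₙ(F[G])`, `A * B = 1` implies
`B * A = 1`.  (Theorem of Kaplansky.) -/
theorem stmt_3 (F : Type*) [Field F] [CharZero F] (G : Type*) [Group G]
    (n : ℕ) (hn : 1 ≤ n) (A B : Matrix (Fin n) (Fin n) (MonoidAlgebra F G))
    (hAB : A * B = 1) : B * A = 1 := by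
  by_contra hBA
  obtain ⟨i, j, g, hc⟩ : ∃ i j g, ((B * A - 1) i j).coeff g ≠ 0 := by
    by_contra! h
    exact hBA (sub_eq_zero.mp (by ext i j g; exact h i j g))
  let coeffs (M : Matrix (Fin n) (Fin n) (MonoidAlgebra F G)) : Set F :=
    ⋃ i, ⋃ j, Set.range (M i j).coeff
  have hcoeffs (M) : (coeffs M).Finite :=
    Set.finite_iUnion fun i ↦ Set.finite_iUnion fun j ↦ (M i j).coeff.finite_range
  obtain ⟨S, f, hS, hf⟩ := exists_subring_ringHom_complex ((hcoeffs A).union (hcoeffs B)) hc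
  let φ := (MonoidAlgebra.mapRingHom G S.subtype).mapMatrix (m := Fin n)
  have hφ : Function.Injective φ := Matrix.map_injective
    (MonoidAlgebra.map_injective _ Subtype.val_injective)
  have hlift (M) (hM : coeffs M ⊆ S) : ∃ M', φ M' = M := by
    have hentry (i j) : ∃ x, MonoidAlgebra.mapRingHom G S.subtype x = M i j := by
      change M i j ∈ Set.range (MonoidAlgebra.map S.subtype.toAddMonoidHom)
      rw [MonoidAlgebra.range_map]
      exact fun h ↦ ⟨⟨_, hM (Set.mem_iUnion₂.mpr ⟨i, j, h, rfl⟩)⟩, rfl⟩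
    choose M' hM' using hentry
    exact ⟨Matrix.of M', by ext1 i j; exact hM' i j⟩
  obtain ⟨A', rfl⟩ := hlift A (Set.subset_union_left.trans hS)
  obtain ⟨B', rfl⟩ := hlift B (Set.subset_union_right.trans hS)
  have hAB' : A' * B' = 1 := hφ (by rw [map_mul, hAB, map_one])
  let ψ := (MonoidAlgebra.mapRingHom G f).mapMatrix (m := Fin n)
  have hψ : ψ (B' * A' - 1) = 0 := by
    rw [map_sub, map_mul, map_one, sub_eq_zero, mul_eq_one_comm, ← map_mul, hAB', map_one]
  refine hf (((B' * A' - 1) i j).coeff g) ?_ ?_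
  · rw [← map_mul, ← map_one φ, ← map_sub]
    simp [φ]
  · simpa [ψ] using congrArg (fun M ↦ (M i j).coeff g) hψ
end

section
/- Let R be a ring all of whose idempotents are trivial, let G be a group, and suppose the group ring R[G] is stably finite. Assume that for every finitely generated projective R[G]-module Q there exist an integer k ≥ 1, a finitely generated projective R-module P, and integers m, n ≥ 0 such that Q^{⊕k} ⊕ R[G]^m ≅ (R[G] ⊗_R P) ⊕ R[G]^n as R[G]-modules (this expresses that the map K₀(R) ⊗ ℚ → K₀(R[G]) ⊗ ℚ induced by the inclusion R → R[G] is surjective). Then every idempotent of R[G] is trivial. -/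
universe u

open Matrix

/-- The augmentation `R[G] → R`, for a not necessarily commutative ring `R`. -/
noncomputable def augmentation (R G : Type*) [Ring R] [Group G] : MonoidAlgebra R G →+* R :=
  MonoidAlgebra.liftNCRingHom (RingHom.id R) (1 : G →* R) fun _ _ => by
    simp [Commute.one_right]

theorem augmentation_singleOneRingHom {R G : Type*} [Ring R] [Group G] (r : R) :
    augmentation R G (MonoidAlgebra.singleOneRingHom r) = r := by
  simp [augmentation, MonoidAlgebra.singleOneRingHom]

/-- If two idempotent matrices have isomorphic images, exhibited as retracts of free modules,
then they are Murray-von Neumann equivalent. -/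
theorem exists_matrix_mul_eq_of_linearEquiv {S : Type*} [Ring S] {a b : Type*}
    [Fintype a] [DecidableEq a] [Fintype b] [DecidableEq b]
    {M N : Type*} [AddCommGroup M] [Module S M] [AddCommGroup N] [Module S N]
    {e : Matrix a a S} {f : Matrix b b S}
    (i : M →ₗ[S] a → S) (q : (a → S) →ₗ[S] M) (hqi : q ∘ₗ i = LinearMap.id)
    (hiq : i ∘ₗ q = e.vecMulLinear)
    (j : N →ₗ[S] b → S) (r : (b → S) →ₗ[S] N) (hrj : r ∘ₗ j = LinearMap.id)
    (hjr : j ∘ₗ r = f.vecMulLinear) (φ : M ≃ₗ[S] N) :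
    ∃ (X : Matrix a b S) (Y : Matrix b a S), X * Y = e ∧ Y * X = f := by
  obtain ⟨X, hX⟩ := (LinearMap.toMatrixRight' (R := S)).symm.surjective
    (j ∘ₗ φ.toLinearMap ∘ₗ q)
  obtain ⟨Y, hY⟩ := (LinearMap.toMatrixRight' (R := S)).symm.surjective
    (i ∘ₗ φ.symm.toLinearMap ∘ₗ r)
  refine ⟨X, Y, ?_, ?_⟩
  · apply (LinearMap.toMatrixRight' (R := S)).symm.injective
    change toLinearMapRight' (X * Y) = toLinearMapRight' e
    rw [toLinearMapRight'_mul]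
    change toLinearMapRight' Y = _ at hY
    change toLinearMapRight' X = _ at hX
    rw [hX, hY]
    change _ = e.vecMulLinear
    rw [← hiq]
    refine LinearMap.ext fun x => ?_
    have h (y : N) : r (j y) = y := LinearMap.congr_fun hrj y
    simp [h]
  · apply (LinearMap.toMatrixRight' (R := S)).symm.injective
    change toLinearMapRight' (Y * X) = toLinearMapRight' f
    rw [toLinearMapRight'_mul]
    change toLinearMapRight' Y = _ at hY
    change toLinearMapRight' X = _ at hX
    rw [hX, hY]
    change _ = f.vecMulLinear
    rw [← hjr]
    refine LinearMap.ext fun x => ?_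
    have h (y : M) : q (i y) = y := LinearMap.congr_fun hqi y
    simp [h]

/-- Let `d ≤ e` be equivalent idempotent matrices, where `d = K * J` is equivalent to the
identity matrix of size `m`. If the ring of `m × m` matrices is directly finite, then `e = d`. -/
theorem eq_of_equivalent_of_directlyFinite {S : Type*} [Ring S] {a m : Type*}
    [Fintype a] [DecidableEq a] [Fintype m] [DecidableEq m]
    (hfin : ∀ A B : Matrix m m S, A * B = 1 → B * A = 1)
    {e d U V : Matrix a a S} {J : Matrix m a S} {K : Matrix a m S}
    (he : e * e = e) (hed : e * d = d) (hde : d * e = d)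
    (hJK : J * K = 1) (hKJ : K * J = d) (hUV : U * V = e) (hVU : V * U = d) : e = d := by
  have hdd : d * d = d := by
    rw [← hKJ, Matrix.mul_assoc, ← Matrix.mul_assoc J, hJK, Matrix.one_mul]
  have hJd : J * d = J := by rw [← hKJ, ← Matrix.mul_assoc, hJK, Matrix.one_mul]
  have hUdV : U * d * V = e := by
    rw [← hVU, ← Matrix.mul_assoc, hUV, Matrix.mul_assoc, hUV, he]
  have hVeU : V * e * U = d := by
    rw [← hUV, ← Matrix.mul_assoc, hVU, Matrix.mul_assoc, hVU, hdd]
  have h1 : (J * U * K) * (J * V * K) = 1 := by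
    calc (J * U * K) * (J * V * K) = J * (U * (K * J) * V) * K := by
          simp only [Matrix.mul_assoc]
      _ = 1 := by
          rw [hKJ, hUdV]
          calc J * e * K = J * d * e * K := by rw [hJd]
            _ = 1 := by rw [Matrix.mul_assoc J, hde, hJd, hJK]
  have h2 : J * (V * d * U) * K = 1 := by
    rw [← hfin _ _ h1, ← hKJ]
    simp only [Matrix.mul_assoc]
  have h3 : J * (V * (e - d) * U) * K = 0 := by
    rw [Matrix.mul_sub, Matrix.sub_mul, Matrix.mul_sub, Matrix.sub_mul, h2, hVeU, hJd, hJK,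
      sub_self]
  have hsq : (e - d) * (e - d) = e - d := by
    simp only [mul_sub, sub_mul, he, hed, hde, hdd]; abel
  have hmid : (e - d) * (U * d * V) * (e - d) = e - d := by
    rw [hUdV, sub_mul e d e, he, hde, hsq]
  rw [← sub_eq_zero]
  calc e - d = (e - d) * (U * d * V) * (e - d) * ((e - d) * (U * d * V) * (e - d)) := by
        rw [hmid, hsq]
    _ = (e - d) * U * K * (J * (V * ((e - d) * (e - d)) * U) * K) * (J * V * (e - d)) := by
        rw [← hKJ]; simp only [Matrix.mul_assoc]
    _ = 0 := by rw [hsq, h3]; simp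

/-- Let `ε : S → R` be a retraction of `ι : R → S` and let `p` be an idempotent of the stably
finite ring `S` killed by `ε`. If a positive multiple of the class of `S p` comes from `R` up to
free summands, then `p = 0`. -/
theorem idempotent_eq_zero_of_retraction_eq_zero {R S : Type*} [Ring R] [Ring S]
    (hsf : ∀ n : ℕ, 1 ≤ n → ∀ A B : Matrix (Fin n) (Fin n) S, A * B = 1 → B * A = 1)
    (ι : R →+* S) (ε : S →+* R) (hει : ∀ r, ε (ι r) = r)
    {p : S} (hp : p * p = p) (hεp : ε p = 0)
    {k : ℕ} (hk : 1 ≤ k) {N : ℕ} {E : Matrix (Fin N) (Fin N) R} (hE : E * E = E) {m n : ℕ}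
    (φ : ((Fin k → LinearMap.range (LinearMap.toSpanSingleton S S p)) × (Fin m → S)) ≃ₗ[S]
      (LinearMap.range (E.map ⇑ι).vecMulLinear × (Fin n → S))) : p = 0 := by
  set F := E.map ι
  have hF : F * F = F := by rw [← Matrix.map_mul, hE]
  set t := LinearMap.toSpanSingleton S S p
  have htt (x : S) : t (t x) = t x := by simp [t, mul_assoc, hp]
  have hFF (x : Fin N → S) : F.vecMulLinear (F.vecMulLinear x) = F.vecMulLinear x := by
    simp [hF]
  let e : Matrix (Fin k ⊕ Fin m) (Fin k ⊕ Fin m) S := fromBlocks (diagonal fun _ => p) 0 0 1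
  let f : Matrix (Fin N ⊕ Fin n) (Fin N ⊕ Fin n) S := fromBlocks F 0 0 1
  let d : Matrix (Fin k ⊕ Fin m) (Fin k ⊕ Fin m) S := fromBlocks 0 0 0 1
  have he : e * e = e := by simp [e, fromBlocks_multiply, hp]
  have hd : d * d = d := by simp [d, fromBlocks_multiply]
  obtain ⟨X, Y, hXY, hYX⟩ := exists_matrix_mul_eq_of_linearEquiv (e := e) (f := f)
    ((LinearEquiv.sumArrowLequivProdArrow (Fin k) (Fin m) S S).symm.toLinearMap ∘ₗ
      LinearMap.prodMap ((LinearMap.range t).subtype.compLeft (Fin k)) LinearMap.id)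
    (LinearMap.prodMap (t.rangeRestrict.compLeft (Fin k)) LinearMap.id ∘ₗ
      (LinearEquiv.sumArrowLequivProdArrow (Fin k) (Fin m) S S).toLinearMap)
    (by
      refine LinearMap.ext fun x => Prod.ext (funext fun i => Subtype.ext ?_) rfl
      obtain ⟨y, hy⟩ := (x.1 i).2
      change t (x.1 i) = x.1 i
      rw [← hy, htt])
    (by
      refine LinearMap.ext fun x => funext fun i => ?_
      rcases i with i | i
      · change t (x (Sum.inl i)) = (x ᵥ* e) (Sum.inl i)
        simp [e, t, vecMul_fromBlocks]
      · change x (Sum.inr i) = (x ᵥ* e) (Sum.inr i)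
        simp [e, vecMul_fromBlocks])
    ((LinearEquiv.sumArrowLequivProdArrow (Fin N) (Fin n) S S).symm.toLinearMap ∘ₗ
      LinearMap.prodMap (LinearMap.range F.vecMulLinear).subtype LinearMap.id)
    (LinearMap.prodMap F.vecMulLinear.rangeRestrict LinearMap.id ∘ₗ
      (LinearEquiv.sumArrowLequivProdArrow (Fin N) (Fin n) S S).toLinearMap)
    (by
      refine LinearMap.ext fun x => Prod.ext (Subtype.ext ?_) rfl
      obtain ⟨y, hy⟩ := x.1.2
      change F.vecMulLinear x.1 = x.1
      rw [← hy, hFF])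
    (by
      refine LinearMap.ext fun x => funext fun i => ?_
      rcases i with i | i
      · change ((x ∘ Sum.inl) ᵥ* F) i = (x ᵥ* f) (Sum.inl i)
        simp [f, vecMul_fromBlocks]
      · change x (Sum.inr i) = (x ᵥ* f) (Sum.inr i)
        simp [f, vecMul_fromBlocks])
    φ
  -- Pushing forward along `ι ∘ ε` fixes `f` and sends `e` to `d`.
  have hXY' : X.map (ι.comp ε) * Y.map (ι.comp ε) = d := by
    rw [← Matrix.map_mul, hXY]
    simp [e, d, fromBlocks_map, diagonal_map, hεp, Function.comp_def, Matrix.map_one]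
  have hYX' : Y.map (ι.comp ε) * X.map (ι.comp ε) = f := by
    rw [← Matrix.map_mul, hYX]
    have hF' : F.map (ι ∘ ε) = F := by
      ext1 i j
      simp [F, hει]
    simp [f, fromBlocks_map, hF', Matrix.map_one]
  set X' := X.map (ι.comp ε)
  set Y' := Y.map (ι.comp ε)
  have hUV : (X * Y') * (X' * Y) = e := by
    calc (X * Y') * (X' * Y) = X * (Y' * X') * Y := by simp only [Matrix.mul_assoc]
      _ = (X * Y) * (X * Y) := by rw [hYX', ← hYX]; simp only [Matrix.mul_assoc]
      _ = e := by rw [hXY, he]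
  have hVU : (X' * Y) * (X * Y') = d := by
    calc (X' * Y) * (X * Y') = X' * (Y * X) * Y' := by simp only [Matrix.mul_assoc]
      _ = (X' * Y') * (X' * Y') := by rw [hYX, ← hYX']; simp only [Matrix.mul_assoc]
      _ = d := by rw [hXY', hd]
  have hfin (A B : Matrix (Fin m) (Fin m) S) (h : A * B = 1) : B * A = 1 := by
    rcases Nat.eq_zero_or_pos m with rfl | hm
    · exact Subsingleton.elim _ _
    · exact hsf m hm A B h
  have hed : e = d := eq_of_equivalent_of_directlyFinite hfin
    (J := fromCols 0 1) (K := fromRows 0 1) he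
    (by simp [e, d, fromBlocks_multiply]) (by simp [e, d, fromBlocks_multiply])
    (by simp [fromCols_mul_fromRows])
    (by rw [fromRows_mul_fromCols]; simp [d]) hUV hVU
  simpa [e, d] using congr_fun₂ hed (Sum.inl ⟨0, hk⟩) (Sum.inl ⟨0, hk⟩)

/-- Let `R` be a ring all of whose idempotents are trivial, let `G` be a group, and suppose
the group ring `R[G]` is stably finite.  Assume that for every finitely generated projective
`R[G]`-module `Q` there exist `k ≥ 1`, a finitely generated projective `R`-module `P`, and
`m, n ≥ 0` with `Q^{⊕k} ⊕ R[G]^m ≅ (R[G] ⊗_R P) ⊕ R[G]^n` as `R[G]`-modules.  Then every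
idempotent of `R[G]` is trivial.

Since `R` need not be commutative, the induced module `R[G] ⊗_R P` is encoded as follows:
`P` is (up to `R`-isomorphism) the image of right multiplication by an idempotent matrix `E`
over `R` on a finite free module, and `R[G] ⊗_R P` is then the image of right multiplication
by the idempotent matrix over `R[G]` obtained by applying the inclusion
`R → R[G]` (`MonoidAlgebra.singleOneRingHom`) to the entries of `E`. -/
theorem stmt_4 {R : Type u} [Ring R] (G : Type u) [Group G]
    (hidem : ∀ e : R, e * e = e → e = 0 ∨ e = 1)
    (hsf : ∀ n : ℕ, 1 ≤ n → ∀ A B : Matrix (Fin n) (Fin n) (MonoidAlgebra R G),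
      A * B = 1 → B * A = 1)
    (hK0 : ∀ (Q : Type u) [AddCommGroup Q] [Module (MonoidAlgebra R G) Q],
      Module.Finite (MonoidAlgebra R G) Q → Module.Projective (MonoidAlgebra R G) Q →
      ∃ k : ℕ, 1 ≤ k ∧
        ∃ (P : Type u) (_ : AddCommGroup P) (_ : Module R P),
          Module.Finite R P ∧ Module.Projective R P ∧
          ∃ (N : ℕ) (E : Matrix (Fin N) (Fin N) R), E * E = E ∧
            Nonempty (P ≃ₗ[R] LinearMap.range E.vecMulLinear) ∧
            ∃ m n : ℕ,
              Nonempty (((Fin k → Q) × (Fin m → MonoidAlgebra R G)) ≃ₗ[MonoidAlgebra R G]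
                (LinearMap.range
                    (E.map ⇑(MonoidAlgebra.singleOneRingHom :
                      R →+* MonoidAlgebra R G)).vecMulLinear ×
                  (Fin n → MonoidAlgebra R G))))
    (p : MonoidAlgebra R G) (hp : p * p = p) : p = 0 ∨ p = 1 := by
  have key (q : MonoidAlgebra R G) (hq : q * q = q) (hεq : augmentation R G q = 0) :
      q = 0 := by
    let t := LinearMap.toSpanSingleton (MonoidAlgebra R G) (MonoidAlgebra R G) q
    have hproj : Module.Projective (MonoidAlgebra R G) (LinearMap.range t) := by
      refine Module.Projective.of_split (LinearMap.range t).subtype t.rangeRestrict ?_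
      ext ⟨_, y, rfl⟩ : 2
      simp [t, mul_assoc, hq]
    obtain ⟨k, hk, _, _, _, _, _, N, E, hE, _, m, n, ⟨φ⟩⟩ :=
      hK0 (LinearMap.range t) inferInstance hproj
    exact idempotent_eq_zero_of_retraction_eq_zero hsf _ _ augmentation_singleOneRingHom
      hq hεq hk hE φ
  rcases hidem (augmentation R G p) (by rw [← map_mul, hp]) with h | h
  · exact Or.inl (key p hp h)
  · refine Or.inr (sub_eq_zero.mp (key (1 - p) ?_ ?_)).symm
    · simp [mul_sub, sub_mul, hp]
    · simp [h]
end
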